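/- Let X be a completely regular (Hausdorff) topological space and let H be a non-vanishing self-adjoint closed subalgebra of C_B(X) which separates points from closed sets in X, and let λ_H X = ⋃_{h∈H} Coz(h_α) ⊆ α_H X. Then the following are equivalent: (1) H is a unital algebra (H has a multiplicative identity element); (2) the constant function 1 on X belongs to H; (3) λ_H X is compact; (4) λ_H X = α_H X. -/

import Mathlib

open Set Topology

/-- `H ⊆ C_B(X)` separates points from closed sets in `X`. -/
def SeparatesPointsFromClosedSets {X : Type*} [TopologicalSpace X]
    (H : Set (BoundedContinuousFunction X ℂ)) : Prop :=
  ∀ C : Set X, IsClosed C → ∀ x ∉ C, ∃ h ∈ H, h x ∉ closure ((h : X → ℂ) '' C)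

/-- The evaluation map `e : X → ∏_{h ∈ H} cl_ℂ(h(X))`. -/
noncomputable def evalMap {X : Type*} [TopologicalSpace X]
    (H : Set (BoundedContinuousFunction X ℂ)) (x : X) :
    (h : H) → (closure (Set.range ((h : BoundedContinuousFunction X ℂ) : X → ℂ)) : Set ℂ) :=
  fun h => ⟨(h : BoundedContinuousFunction X ℂ) x, subset_closure ⟨x, rfl⟩⟩

/-- The compactification `α_H X`, as the closure of `e(X)` in the product. -/
noncomputable def alphaSet {X : Type*} [TopologicalSpace X]
    (H : Set (BoundedContinuousFunction X ℂ)) :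
    Set ((h : H) → (closure (Set.range ((h : BoundedContinuousFunction X ℂ) : X → ℂ)) : Set ℂ)) :=
  closure (Set.range (evalMap H))

/-- The corestriction `X → α_H X` of the evaluation map. -/
noncomputable def evalAlpha {X : Type*} [TopologicalSpace X]
    (H : Set (BoundedContinuousFunction X ℂ)) (x : X) : alphaSet H :=
  ⟨evalMap H x, subset_closure ⟨x, rfl⟩⟩

/-- The extension `h_α : α_H X → ℂ` of `h ∈ H`, i.e. the restriction to `α_H X` of the
projection onto the `h`-th coordinate. -/
noncomputable def hAlpha {X : Type*} [TopologicalSpace X]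
    (H : Set (BoundedContinuousFunction X ℂ)) (h : H) (z : alphaSet H) : ℂ :=
  (z.1 h : ℂ)

/-- The subspace `λ_H X = ⋃_{h ∈ H} Coz(h_α)` of `α_H X`. -/
noncomputable def lambdaSet {X : Type*} [TopologicalSpace X]
    (H : Set (BoundedContinuousFunction X ℂ)) : Set (alphaSet H) :=
  {z : alphaSet H | ∃ h : H, hAlpha H h z ≠ 0}

section

variable {X : Type*} [TopologicalSpace X]

lemma isCompact_alphaSet (H : Set (BoundedContinuousFunction X ℂ)) : IsCompact (alphaSet H) := by
  have : ∀ h : H, CompactSpace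
      (closure (Set.range ((h : BoundedContinuousFunction X ℂ) : X → ℂ)) : Set ℂ) := fun h =>
    isCompact_iff_compactSpace.mp h.1.isBounded_range.isCompact_closure
  exact isClosed_closure.isCompact

lemma continuous_hAlpha (H : Set (BoundedContinuousFunction X ℂ)) (h : H) :
    Continuous (hAlpha H h) :=
  continuous_subtype_val.comp ((continuous_apply h).comp continuous_subtype_val)

lemma denseRange_evalAlpha (H : Set (BoundedContinuousFunction X ℂ)) :
    DenseRange (evalAlpha H) := by
  rintro ⟨z, hz⟩
  rw [closure_subtype, ← Set.range_comp]
  exact hz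

/-- A closed non-unital subalgebra of a normed ring containing an element at distance less than
one from `1` contains `1`. -/
lemma one_mem_of_norm_one_sub_lt {A : Type*} [NormedRing A] [NormedAlgebra ℂ A]
    (H : NonUnitalSubalgebra ℂ A) (hclosed : IsClosed (H : Set A)) {a : A} (ha : a ∈ H)
    (hlt : ‖1 - a‖ < 1) : (1 : A) ∈ H := by
  have hpow : ∀ n : ℕ, 1 - (1 - a) ^ n ∈ H := by
    intro n
    induction n with
    | zero => simp
    | succ n ih =>
      have : 1 - (1 - a) ^ (n + 1) = (1 - (1 - a) ^ n) + a - (1 - (1 - a) ^ n) * a := by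
        rw [pow_succ]
        noncomm_ring
      rw [this]
      exact sub_mem (add_mem ih ha) (mul_mem ih ha)
  have hlim : Filter.Tendsto (fun n : ℕ => 1 - (1 - a) ^ n) Filter.atTop (𝓝 (1 - 0)) :=
    tendsto_const_nhds.sub (tendsto_pow_atTop_nhds_zero_of_norm_lt_one hlt)
  rw [sub_zero] at hlim
  exact hclosed.mem_of_tendsto hlim (Filter.Eventually.of_forall hpow)

/-- A closed non-unital subalgebra of `C_B(X)` containing a real function bounded below by a
positive constant contains the constant function `1`. -/
lemma one_mem_of_pos_le (H : NonUnitalSubalgebra ℂ (BoundedContinuousFunction X ℂ))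
    (hclosed : IsClosed (H : Set (BoundedContinuousFunction X ℂ)))
    {f : BoundedContinuousFunction X ℂ} (hf : f ∈ H) {c : ℝ} (hc : 0 < c)
    (hfc : ∀ x, ∃ r : ℝ, f x = r ∧ c ≤ r) : (1 : BoundedContinuousFunction X ℂ) ∈ H := by
  set M : ℝ := ‖f‖ + c with hM
  have hM0 : 0 < M := by positivity
  have hcM : c / M ≤ 1 := (div_le_one hM0).2 (by rw [hM]; linarith [norm_nonneg f])
  refine one_mem_of_norm_one_sub_lt H hclosed (H.smul_mem ((M⁻¹ : ℝ) : ℂ) hf) ?_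
  refine lt_of_le_of_lt (b := 1 - c / M) ?_ (by linarith [div_pos hc hM0])
  refine (BoundedContinuousFunction.norm_le (by linarith)).2 fun x => ?_
  obtain ⟨r, hr, hcr⟩ := hfc x
  have hrM : r ≤ M := by
    have h := f.norm_coe_le_norm x
    rw [hr, Complex.norm_real] at h
    linarith [le_abs_self r, Real.norm_eq_abs r]
  have hval : (1 - ((M⁻¹ : ℝ) : ℂ) • f) x = ((1 - r / M : ℝ) : ℂ) := by
    simp [hr, div_eq_inv_mul]
  have h1 : r / M ≤ 1 := (div_le_one hM0).2 hrM
  have h2 : c / M ≤ r / M := by gcongr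
  rw [hval, Complex.norm_real, Real.norm_of_nonneg (by linarith)]
  linarith

/-- Finitely many members of a family of continuous functions without common zeros on a compact
space are jointly bounded away from zero. -/
lemma exists_finset_le_sum_norm_sq {Z ι : Type*} [TopologicalSpace Z] [CompactSpace Z]
    {f : ι → Z → ℂ} (hf : ∀ i, Continuous (f i)) (hne : ∀ z, ∃ i, f i z ≠ 0) :
    ∃ (t : Finset ι) (c : ℝ), 0 < c ∧ ∀ z, c ≤ ∑ i ∈ t, ‖f i z‖ ^ 2 := by
  obtain ⟨t, ht⟩ := isCompact_univ.elim_finite_subcover (fun i => {z | f i z ≠ 0})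
    (fun i => isOpen_ne_fun (hf i) continuous_const)
    (fun z _ => Set.mem_iUnion.2 (hne z))
  have hcont : Continuous fun z => ∑ i ∈ t, ‖f i z‖ ^ 2 :=
    continuous_finsetSum t fun i _ => (hf i).norm.pow 2
  have hpos : ∀ z ∈ Set.univ, 0 < ∑ i ∈ t, ‖f i z‖ ^ 2 := fun z hz => by
    obtain ⟨i, hit, hi⟩ := Set.mem_iUnion₂.1 (ht hz)
    exact Finset.sum_pos' (fun _ _ => by positivity) ⟨i, hit, pow_pos (norm_pos_iff.2 hi) 2⟩
  obtain ⟨c, hc, hle⟩ := isCompact_univ.exists_forall_le' hcont.continuousOn hpos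
  exact ⟨t, c, hc, fun z => hle z (Set.mem_univ z)⟩

/-- If `λ_H X = α_H X`, then finitely many elements of `H` are jointly bounded away from zero. -/
lemma exists_le_sum_sq_of_lambdaSet_eq_univ (H : Set (BoundedContinuousFunction X ℂ))
    (huniv : lambdaSet H = Set.univ) :
    ∃ (t : Finset H) (c : ℝ), 0 < c ∧ ∀ x, c ≤ ∑ h ∈ t, ‖h.1 x‖ ^ 2 := by
  have : CompactSpace (alphaSet H) := isCompact_iff_compactSpace.mp (isCompact_alphaSet H)
  obtain ⟨t, c, hc, hle⟩ := exists_finset_le_sum_norm_sq (continuous_hAlpha H)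
    fun z => Set.eq_univ_iff_forall.1 huniv z
  exact ⟨t, c, hc, fun x => hle (evalAlpha H x)⟩

/-- If `λ_H X = α_H X`, then a closed self-adjoint `H` contains the constant function `1`. -/
lemma one_mem_of_lambdaSet_eq_univ
    (H : NonUnitalStarSubalgebra ℂ (BoundedContinuousFunction X ℂ))
    (hclosed : IsClosed (H : Set (BoundedContinuousFunction X ℂ)))
    (huniv : lambdaSet (H : Set (BoundedContinuousFunction X ℂ)) = Set.univ) :
    (1 : BoundedContinuousFunction X ℂ) ∈ H := by
  obtain ⟨t, c, hc, hle⟩ := exists_le_sum_sq_of_lambdaSet_eq_univ _ huniv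
  have hmem : ∑ h ∈ t, star h.1 * h.1 ∈ H :=
    sum_mem fun h _ => mul_mem (star_mem (show h.1 ∈ H from h.2)) h.2
  refine one_mem_of_pos_le H.toNonUnitalSubalgebra hclosed hmem hc fun x => ⟨_, ?_, hle x⟩
  simp [BoundedContinuousFunction.sum_apply, Complex.conj_mul']

end

/-- the following are equivalent: (1) `H` is unital; (2) the constant
function `1` belongs to `H`; (3) `λ_H X` is compact; (4) `λ_H X = α_H X`. -/
theorem tfae_unital_compact {X : Type*} [TopologicalSpace X]
    [CompletelyRegularSpace X] [T2Space X]
    (H : NonUnitalStarSubalgebra ℂ (BoundedContinuousFunction X ℂ))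
    (hclosed : IsClosed (H : Set (BoundedContinuousFunction X ℂ)))
    (hnv : ∀ x : X, ∃ h ∈ H, h x ≠ 0)
    (hsep : SeparatesPointsFromClosedSets (H : Set (BoundedContinuousFunction X ℂ))) :
    List.TFAE
      [ (∃ u ∈ H, ∀ h ∈ H, u * h = h ∧ h * u = h),
        (1 : BoundedContinuousFunction X ℂ) ∈ H,
        IsCompact (lambdaSet (H : Set (BoundedContinuousFunction X ℂ))),
        lambdaSet (H : Set (BoundedContinuousFunction X ℂ)) = Set.univ ] := by
  have hevalmem : ∀ x, evalAlpha (H : Set (BoundedContinuousFunction X ℂ)) x ∈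
      lambdaSet (H : Set (BoundedContinuousFunction X ℂ)) := fun x => by
    obtain ⟨h, hH, hx⟩ := hnv x
    exact ⟨⟨h, hH⟩, hx⟩
  tfae_have 1 → 2 := by
    rintro ⟨u, hu, hmul⟩
    have : u = 1 := by
      ext x
      obtain ⟨h, hH, hx⟩ := hnv x
      have := DFunLike.congr_fun (hmul h hH).1 x
      exact mul_right_cancel₀ hx (by simpa using this)
    exact this ▸ hu
  tfae_have 2 → 1 := fun h => ⟨1, h, fun f _ => ⟨one_mul f, mul_one f⟩⟩
  tfae_have 2 → 4 := by
    intro h1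
    refine Set.eq_univ_of_forall fun z => ⟨⟨1, h1⟩, ?_⟩
    have hmem := (z.1 ⟨1, h1⟩).2
    have hsub : closure (Set.range ((1 : BoundedContinuousFunction X ℂ) : X → ℂ)) ⊆ {1} :=
      closure_minimal (by rintro _ ⟨x, rfl⟩; rfl) isClosed_singleton
    have hval : hAlpha _ ⟨1, h1⟩ z = 1 := hsub hmem
    rw [hval]
    exact one_ne_zero
  tfae_have 4 → 3 := by
    intro h
    rw [h]
    exact isCompact_iff_isCompact_univ.mp (isCompact_alphaSet _)
  tfae_have 3 → 4 := by
    intro h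
    refine Set.eq_univ_of_univ_subset ?_
    rw [← (denseRange_evalAlpha _).closure_range]
    exact closure_minimal (Set.range_subset_iff.2 hevalmem) h.isClosed
  tfae_have 4 → 2 := one_mem_of_lambdaSet_eq_univ H hclosed
  tfae_finish
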